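/- Let α ∈ (0,1] and t > 0. If f is differentiable at t, then the Katugampola fractional derivative D^α f(t) = lim_{ε→0}(f(t·e^{ε·t^{-α}}) − f(t))/ε exists and equals t^{1-α}·f'(t). -/

import Mathlib

open Topology Filter

theorem katugampola_eq_conformable (f : ℝ → ℝ) (t f' α : ℝ) (ht : 0 < t)
    (hα : α ∈ Set.Ioc (0:ℝ) 1) (hf : HasDerivAt f f' t) :
    Tendsto (fun ε : ℝ => (f (t * Real.exp (ε * t ^ (-α))) - f t) / ε)
      (𝓝[≠] (0:ℝ)) (𝓝 (t ^ (1 - α) * f')) := by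
  have hg : HasDerivAt (fun ε : ℝ => t * Real.exp (ε * t ^ (-α))) (t ^ (1 - α)) 0 := by
    have h := (((hasDerivAt_id (0 : ℝ)).mul_const (t ^ (-α))).exp).const_mul t
    have hpow : t ^ (1 - α) = t * t ^ (-α) := by
      rw [sub_eq_add_neg, Real.rpow_add ht, Real.rpow_one]
    simpa [hpow] using h
  have hcomp : HasDerivAt (fun ε : ℝ => f (t * Real.exp (ε * t ^ (-α))))
      (f' * t ^ (1 - α)) 0 :=
    HasDerivAt.comp (h₂ := f) (0 : ℝ) (by simpa using hf) hg
  simpa [div_eq_inv_mul, mul_comm f'] using hcomp.tendsto_slope_zero
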